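/- There is no pure state ψ of 6 qubits such that the reduction of ψ to every 2-element subset of qubit positions is maximally mixed and exactly 18 of the 20 three-element subsets of qubit positions have maximally mixed reductions. -/

import Mathlib

open Finset

/-- Monotonicity of an access structure on `n` players (players = `Fin n`). -/
def Monotonic {n : ℕ} (Γ : Finset (Fin n) → Prop) : Prop :=
  ∀ A B : Finset (Fin n), Γ A → A ⊆ B → Γ B

/-- No-cloning: a set is authorized iff its complement is not. -/
def NoCloning {n : ℕ} (Γ : Finset (Fin n) → Prop) : Prop :=
  ∀ A : Finset (Fin n), Γ A ↔ ¬ Γ Aᶜ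

/-- `A` is a minimal authorized set of `Γ`. -/
def IsMinimal {n : ℕ} (Γ : Finset (Fin n) → Prop) (A : Finset (Fin n)) : Prop :=
  Γ A ∧ ∀ B : Finset (Fin n), B ⊂ A → ¬ Γ B

/-- No-redundancy: every player lies in some minimal authorized set. -/
def NoRedundancy {n : ℕ} (Γ : Finset (Fin n) → Prop) : Prop :=
  ∀ i : Fin n, ∃ A : Finset (Fin n), IsMinimal Γ A ∧ i ∈ A

noncomputable section

/-- Combine an assignment on `A` and one on `Aᶜ` into a full bit string. -/
def glue {m : ℕ} (A : Finset (Fin m)) (u : {x // x ∈ A} → Fin 2)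
    (w : {x // x ∈ Aᶜ} → Fin 2) : Fin m → Fin 2 :=
  fun x => if h : x ∈ A then u ⟨x, h⟩ else w ⟨x, Finset.mem_compl.mpr h⟩

/-- Reduced density matrix of the pure state `ψ` on the qubit positions in `A`:
the partial trace over the positions outside `A` of `ψψ†`. -/
def reducedDensity {m : ℕ} (ψ : (Fin m → Fin 2) → ℂ) (A : Finset (Fin m)) :
    Matrix ({x // x ∈ A} → Fin 2) ({x // x ∈ A} → Fin 2) ℂ :=
  fun u v => ∑ w : {x // x ∈ Aᶜ} → Fin 2,
    ψ (glue A u w) * (starRingEnd ℂ) (ψ (glue A v w))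

/-- The reduction of `ψ` to `A` is maximally mixed, i.e. equals `2^{-|A|} · I`. -/
def MaximallyMixed {m : ℕ} (ψ : (Fin m → Fin 2) → ℂ) (A : Finset (Fin m)) : Prop :=
  reducedDensity ψ A =
    ((2 : ℂ) ^ A.card)⁻¹ •
      (1 : Matrix ({x // x ∈ A} → Fin 2) ({x // x ∈ A} → Fin 2) ℂ)

open Classical in
/-- Von Neumann entropy (natural logarithm): sum of `-λ log λ` over the eigenvalues. -/
def vnEntropy {ι : Type} [Fintype ι] [DecidableEq ι] (ρ : Matrix ι ι ℂ) : ℝ :=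
  if h : ρ.IsHermitian then ∑ i, Real.negMulLog (h.eigenvalues i) else 0

/-- Entropy of the reduction of `ψ` to the set `A` of qubit positions. -/
def Sent {m : ℕ} (ψ : (Fin m → Fin 2) → ℂ) (A : Finset (Fin m)) : ℝ :=
  vnEntropy (reducedDensity ψ A)

/-- The qubit positions (in `{0,1,…,n} = Fin (n+1)`, where `0` is the reference qubit)
of a set of players `A ⊆ Fin n`: player `i` holds position `i.succ`. -/
def posOf {n : ℕ} (A : Finset (Fin n)) : Finset (Fin (n + 1)) := A.image Fin.succ

/-- `ψ` is a pure QSS state for the access structure `Γ`: a normalized pure state of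
`n+1` qubits (position `0` being the reference qubit `R`) satisfying Recoverability
`S(R) + S(A) - S(R ∪ A) = 2 log 2` for authorized `A` and Secrecy
`S(R) + S(B) - S(R ∪ B) = 0` for unauthorized `B`. -/
structure IsPureQSSState {n : ℕ} (Γ : Finset (Fin n) → Prop)
    (ψ : (Fin (n + 1) → Fin 2) → ℂ) : Prop where
  normalized : ∑ x : Fin (n + 1) → Fin 2, ‖ψ x‖ ^ 2 = 1
  recover : ∀ A : Finset (Fin n), Γ A →
    Sent ψ {0} + Sent ψ (posOf A) - Sent ψ (insert 0 (posOf A)) = 2 * Real.log 2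
  secrecy : ∀ B : Finset (Fin n), ¬ Γ B →
    Sent ψ {0} + Sent ψ (posOf B) - Sent ψ (insert 0 (posOf B)) = 0

end

namespace S6

abbrev U := Fin 2 × Fin 2 × Fin 2

def fl : Fin 2 → Fin 2 := ![1, 0]

def sg : Fin 2 → ℂ := ![1, -1]

lemma flip1 (N : Fin 2 → Fin 2 → ℂ) (a a' : Fin 2) :
    sg a * sg a' * N (fl a') (fl a) = (if a = a' then ∑ c, N c c else 0) - N a a' := by
  fin_cases a <;> fin_cases a' <;> simp [sg, fl, Fin.sum_univ_two]

def FF (x : U × Fin 2) : U × Fin 2 := ((fl x.1.1, fl x.1.2.1, fl x.1.2.2), fl x.2)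

def SS (x : U × Fin 2) : ℂ := sg x.1.1 * sg x.1.2.1 * sg x.1.2.2 * sg x.2

lemma fl_fl (a : Fin 2) : fl (fl a) = a := by fin_cases a <;> rfl

lemma sg_sg (a : Fin 2) : sg a * sg a = 1 := by fin_cases a <;> simp [sg]

lemma FF_FF (x : U × Fin 2) : FF (FF x) = x := by simp [FF, fl_fl]

lemma SS_SS (x : U × Fin 2) : SS x * SS x = 1 := by
  have : SS x * SS x = (sg x.1.1 * sg x.1.1) * (sg x.1.2.1 * sg x.1.2.1) *
    (sg x.1.2.2 * sg x.1.2.2) * (sg x.2 * sg x.2) := by unfold SS; ring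
  rw [this]; simp [sg_sg]

def FE : (U × Fin 2) ≃ (U × Fin 2) := ⟨FF, FF, FF_FF, FF_FF⟩

def tl (M : Matrix (U × Fin 2) (U × Fin 2) ℂ) : Matrix (U × Fin 2) (U × Fin 2) ℂ :=
  fun x y => SS x * SS y * M (FF y) (FF x)

lemma tl_mul (M N : Matrix (U × Fin 2) (U × Fin 2) ℂ) : tl (M * N) = tl N * tl M := by
  ext x y
  simp only [tl, Matrix.mul_apply]
  rw [Finset.mul_sum]
  refine (Fintype.sum_equiv FE _ _ fun z => ?_)
  have h1 : FE z = FF z := rfl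
  rw [h1, FF_FF]
  have := SS_SS (FF z)
  linear_combination (-(SS x * SS y * M (FF y) z * N z (FF x))) * this

lemma tl_smul (c : ℂ) (M : Matrix (U × Fin 2) (U × Fin 2) ℂ) : tl (c • M) = c • tl M := by
  ext x y
  simp [tl]; ring

/-- partial trace over the last factor -/
def pt (M : Matrix (U × Fin 2) (U × Fin 2) ℂ) : Matrix U U ℂ :=
  fun u v => ∑ d, M (u, d) (v, d)

def ext1 (T : Matrix U U ℂ) : Matrix (U × Fin 2) (U × Fin 2) ℂ :=
  fun x y => if x.2 = y.2 then T x.1 y.1 else 0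

lemma pt_mul_ext (M : Matrix (U × Fin 2) (U × Fin 2) ℂ) (T : Matrix U U ℂ) :
    pt (M * ext1 T) = pt M * T := by
  ext u v
  simp only [pt, Matrix.mul_apply, ext1, Fintype.sum_prod_type (α₁ := U), mul_ite, mul_zero,
    Finset.sum_ite_eq', Finset.mem_univ, if_true, Finset.sum_mul]
  rw [Finset.sum_comm]

lemma pt_ext_mul (M : Matrix (U × Fin 2) (U × Fin 2) ℂ) (T : Matrix U U ℂ) :
    pt (ext1 T * M) = T * pt M := by
  ext u v
  simp only [pt, Matrix.mul_apply, ext1, Fintype.sum_prod_type (α₁ := U), ite_mul, zero_mul,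
    Finset.sum_ite_eq, Finset.mem_univ, if_true, Finset.mul_sum]
  rw [Finset.sum_comm]

lemma pt_ext (T : Matrix U U ℂ) : pt (ext1 T) = (2 : ℂ) • T := by
  ext u v; simp [pt, ext1]

lemma pt_add (M N : Matrix (U × Fin 2) (U × Fin 2) ℂ) : pt (M + N) = pt M + pt N := by
  ext u v; simp [pt]; ring

lemma pt_smul (c : ℂ) (M : Matrix (U × Fin 2) (U × Fin 2) ℂ) : pt (c • M) = c • pt M := by
  ext u v; simp [pt]; ring

/-- algebraic heart -/
lemma heart (M : Matrix (U × Fin 2) (U × Fin 2) ℂ) (T : Matrix U U ℂ)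
    (hM : M * M = (4 : ℂ) • M) (ht : tl M = M - (2 : ℂ) • ext1 T)
    (hp : pt M = (2 : ℂ) • (1 + T)) : T = 0 := by
  have h1 : tl M * tl M = (4 : ℂ) • tl M := by rw [← tl_mul, hM, tl_smul]
  rw [ht] at h1
  have h2 : M * ext1 T + ext1 T * M = (2 : ℂ) • (ext1 T * ext1 T) + (4 : ℂ) • ext1 T := by
    have h3 : M * M - (2 : ℂ) • (M * ext1 T) - (2 : ℂ) • (ext1 T * M)
        + (4 : ℂ) • (ext1 T * ext1 T) = (4 : ℂ) • M - (8 : ℂ) • ext1 T := by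
      have e : (M - (2 : ℂ) • ext1 T) * (M - (2 : ℂ) • ext1 T) =
        M * M - (2 : ℂ) • (M * ext1 T) - (2 : ℂ) • (ext1 T * M)
        + (4 : ℂ) • (ext1 T * ext1 T) := by
        simp only [sub_mul, mul_sub, smul_mul_assoc, mul_smul_comm]
        module
      rw [← e, h1]; module
    rw [hM] at h3
    have h4 := congrArg (fun X => (-(1/2 : ℂ)) • (X - (4 : ℂ) • M - (4 : ℂ) • (ext1 T * ext1 T))) h3
    calc _ = _ := by module
      _ = _ := h4
      _ = _ := by module
  have h5 := congrArg pt h2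
  rw [pt_add, pt_add, pt_smul, pt_smul, pt_mul_ext, pt_mul_ext, pt_ext_mul, pt_ext, hp] at h5
  have h6 : (8 : ℂ) • T - (4 : ℂ) • T = 0 := by
    have : (2 : ℂ) • (1 + T) * T + T * (2 : ℂ) • (1 + T) = (4 : ℂ) • T + (4 : ℂ) • (T * T) := by
      simp only [smul_mul_assoc, mul_smul_comm, add_mul, mul_add, one_mul, mul_one]
      module
    rw [this, smul_mul_assoc] at h5
    have h7 : (4 : ℂ) • T + (4 : ℂ) • (T * T) - ((4 : ℂ) • T + (4 : ℂ) • (T * T)) = 0 := sub_self _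
    nth_rewrite 1 [h5] at h7
    rw [← h7]; module
  have h8 : (4 : ℂ) • T = 0 := by rw [← h6]; module
  exact (smul_eq_zero.mp h8).resolve_left (by norm_num)

lemma flip3 (n : Fin 2 → Fin 2 → Fin 2 → Fin 2 → Fin 2 → Fin 2 → ℂ) (κ : ℂ)
    (h1 : ∀ b b' c c', ∑ x, n x x b b' c c' = if b = b' ∧ c = c' then κ else 0)
    (h2 : ∀ a a' c c', ∑ x, n a a' x x c c' = if a = a' ∧ c = c' then κ else 0)
    (h3 : ∀ a a' b b', ∑ x, n a a' b b' x x = if a = a' ∧ b = b' then κ else 0)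
    (a a' b b' c c' : Fin 2) :
    sg a * sg a' * (sg b * sg b') * (sg c * sg c') * n (fl a') (fl a) (fl b') (fl b) (fl c') (fl c)
      = (if a = a' ∧ b = b' ∧ c = c' then κ else 0) - n a a' b b' c c' := by
  have f1 := flip1 (fun x y => n x y (fl b') (fl b) (fl c') (fl c)) a a'
  have f2 := flip1 (fun x y => n a a' x y (fl c') (fl c)) b b'
  have f3 := flip1 (fun x y => n a a' b b' x y) c c'
  simp only [h1, h2, h3] at f1 f2 f3
  have key : (sg b * sg b') * (sg c * sg c') *
      (if a = a' then (if fl b' = fl b ∧ fl c' = fl c then κ else 0) else 0)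
      - (sg c * sg c') * (if b = b' then (if a = a' ∧ fl c' = fl c then κ else 0) else 0)
      + (if c = c' then (if a = a' ∧ b = b' then κ else 0) else 0)
      = (if a = a' ∧ b = b' ∧ c = c' then κ else 0) := by
    by_cases ha : a = a' <;> simp only [ha, true_and, false_and, if_true, if_false] <;>
    fin_cases b <;> fin_cases b' <;> fin_cases c <;> fin_cases c' <;> simp [sg, fl]
  linear_combination (sg b * sg b') * (sg c * sg c') * f1 - (sg c * sg c') * f2 + f3 + key

/-- concrete version -/
lemma core (G : Fin 2 → Fin 2 → Fin 2 → Fin 2 → Fin 2 × Fin 2 → ℂ)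
    (h45 : ∀ w w', ∑ a, ∑ b, ∑ c, ∑ d, G a b c d w * (starRingEnd ℂ) (G a b c d w')
      = if w = w' then 1/4 else 0)
    (h013 : ∀ a b d a' b' d', ∑ c, ∑ w, G a b c d w * (starRingEnd ℂ) (G a' b' c d' w)
      = if a = a' ∧ b = b' ∧ d = d' then 1/8 else 0)
    (h023 : ∀ a c d a' c' d', ∑ b, ∑ w, G a b c d w * (starRingEnd ℂ) (G a' b c' d' w)
      = if a = a' ∧ c = c' ∧ d = d' then 1/8 else 0)
    (h123 : ∀ b c d b' c' d', ∑ a, ∑ w, G a b c d w * (starRingEnd ℂ) (G a b' c' d' w)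
      = if b = b' ∧ c = c' ∧ d = d' then 1/8 else 0)
    (a b c a' b' c' : Fin 2) :
    ∑ d, ∑ w, G a b c d w * (starRingEnd ℂ) (G a' b' c' d w)
      = if a = a' ∧ b = b' ∧ c = c' then 1/8 else 0 := by
  obtain ⟨m, hm⟩ : ∃ m : Fin 2 → Fin 2 → Fin 2 → Fin 2 → Fin 2 → Fin 2 → Fin 2 → Fin 2 → ℂ,
    ∀ a a' b b' c c' d d', m a a' b b' c c' d d' =
      ∑ w, G a b c d w * (starRingEnd ℂ) (G a' b' c' d' w) := ⟨_, fun _ _ _ _ _ _ _ _ => rfl⟩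
  simp only [← hm] at h013 h023 h123 ⊢
  obtain ⟨M, hMdef⟩ : ∃ M : Matrix (U × Fin 2) (U × Fin 2) ℂ, ∀ x y, M x y =
    16 * m x.1.1 y.1.1 x.1.2.1 y.1.2.1 x.1.2.2 y.1.2.2 x.2 y.2 := ⟨fun x y => _, fun _ _ => rfl⟩
  obtain ⟨T, hTdef⟩ : ∃ T : Matrix U U ℂ, ∀ u v, T u v =
    8 * (∑ d, m u.1 v.1 u.2.1 v.2.1 u.2.2 v.2.2 d d) - (1 : Matrix U U ℂ) u v :=
    ⟨fun u v => _, fun _ _ => rfl⟩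
  have hM : M * M = (4 : ℂ) • M := by
    obtain ⟨g, hg⟩ : ∃ g : Matrix (U × Fin 2) (Fin 2 × Fin 2) ℂ, ∀ x w, g x w =
      G x.1.1 x.1.2.1 x.1.2.2 x.2 w := ⟨fun x w => _, fun _ _ => rfl⟩
    have e1 : M = (16 : ℂ) • (g * g.conjTranspose) := by
      ext x y
      simp [hMdef, hm, Matrix.mul_apply, hg]
    have e2 : g.conjTranspose * g = (1/4 : ℂ) • 1 := by
      ext w w'
      have := h45 w' w
      simp only [Matrix.mul_apply, Matrix.conjTranspose_apply, hg, Fintype.sum_prod_type (α₁ := U),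
        Fintype.sum_prod_type (α₁ := Fin 2), Matrix.smul_apply, Matrix.one_apply]
      simp only [mul_comm, starRingEnd_apply] at this ⊢
      rw [this]
      by_cases h : w = w'
      · simp [h]
      · simp [h, Ne.symm h]
    rw [e1, smul_mul_assoc, mul_smul_comm, Matrix.mul_assoc, ← Matrix.mul_assoc g.conjTranspose, e2]
    simp [smul_smul]
    norm_num
  have hT := heart M T hM ?_ ?_
  · have := congrFun (congrFun hT (a, b, c)) (a', b', c')
    simp only [hTdef, Matrix.one_apply, Prod.mk.injEq, Matrix.zero_apply] at this
    have h2 : ∑ d, m a a' b b' c c' d d = 1/8 * (if a = a' ∧ b = b' ∧ c = c' then 1 else 0) := by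
      linear_combination (1/8) * this
    rw [h2]; split_ifs <;> simp
  · ext ⟨⟨a, b, c⟩, d⟩ ⟨⟨a', b', c'⟩, d'⟩
    simp only [tl, hMdef, SS, FF, Matrix.sub_apply, Matrix.smul_apply, ext1, smul_eq_mul, hTdef,
      Matrix.one_apply, Prod.mk.injEq]
    have k1 := flip3 (fun a a' b b' c c' => m a a' b b' c c' d d') (if d = d' then 1/8 else 0)
      (by intros; simp only [h123, ← ite_and, and_assoc])
      (by intros; simp only [h023, ← ite_and, and_assoc])
      (by intros; simp only [h013, ← ite_and, and_assoc]) a a' b b' c c'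
    have k2 := flip3 (fun a a' b b' c c' => ∑ e, m a a' b b' c c' e e) (1/4)
      (by intros; rw [Finset.sum_comm]; simp only [h123, and_true, Fin.sum_univ_two]
          split_ifs <;> norm_num)
      (by intros; rw [Finset.sum_comm]; simp only [h023, and_true, Fin.sum_univ_two]
          split_ifs <;> norm_num)
      (by intros; rw [Finset.sum_comm]; simp only [h013, and_true, Fin.sum_univ_two]
          split_ifs <;> norm_num) a a' b b' c c'
    have f4 := flip1 (fun x y => m (fl a') (fl a) (fl b') (fl b) (fl c') (fl c) x y) d d'
    by_cases hd : d = d'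
    · simp only [hd, if_true] at k1 f4 ⊢
      have hh : (if a = a' ∧ b = b' ∧ c = c' then (1/4 : ℂ) else 0) =
        1/4 * (if a = a' ∧ b = b' ∧ c = c' then 1 else 0) := by split_ifs <;> simp
      have hh' : (if a = a' ∧ b = b' ∧ c = c' then (1/8 : ℂ) else 0) =
        1/8 * (if a = a' ∧ b = b' ∧ c = c' then 1 else 0) := by split_ifs <;> simp
      rw [hh] at k2
      rw [hh'] at k1
      linear_combination 16 * (sg a * sg a' * (sg b * sg b') * (sg c * sg c')) * f4
        + 16 * k2 - 16 * k1
    · simp only [hd, if_false, ite_self] at k1 f4 ⊢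
      linear_combination 16 * (sg a * sg a' * (sg b * sg b') * (sg c * sg c')) * f4 - 16 * k1
  · ext ⟨a, b, c⟩ ⟨a', b', c'⟩
    simp only [pt, hMdef, Matrix.smul_apply, Matrix.add_apply, hTdef, ← Finset.mul_sum, smul_eq_mul]
    ring

end S6
namespace S6

open Classical in
lemma mm_iff {m : ℕ} (ψ : (Fin m → Fin 2) → ℂ) (A : Finset (Fin m)) :
    MaximallyMixed ψ A ↔ ∀ x y : Fin m → Fin 2,
      ∑ z : Fin m → Fin 2, ψ (A.piecewise x z) * (starRingEnd ℂ) (ψ (A.piecewise y z))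
        = if ∀ i ∈ A, x i = y i then 1 else 0 := by
  have hpow : ((2 : ℂ) ^ A.card) ≠ 0 := pow_ne_zero _ two_ne_zero
  -- the full sum in terms of the reduced density
  have key : ∀ x y : Fin m → Fin 2,
      ∑ z : Fin m → Fin 2, ψ (A.piecewise x z) * (starRingEnd ℂ) (ψ (A.piecewise y z))
        = 2 ^ A.card * reducedDensity ψ A (fun i => x i) (fun i => y i) := by
    intro x y
    have hg : ∀ (x z : Fin m → Fin 2), A.piecewise x z =
        glue A (fun i => x i) (fun i => z i) := by
      intro x z; ext i
      by_cases h : i ∈ A <;> simp [glue, h]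
    simp only [hg, reducedDensity]
    let E : (Fin m → Fin 2) ≃ ({i // i ∈ A} → Fin 2) × ({i // i ∈ Aᶜ} → Fin 2) :=
      { toFun := fun z => (fun i => z i, fun i => z i)
        invFun := fun p => glue A p.1 p.2
        left_inv := by
          intro z; ext i
          by_cases h : i ∈ A <;> simp [glue, h]
        right_inv := by
          rintro ⟨u, w⟩
          ext i
          · simp [glue, i.2]
          · have := Finset.mem_compl.mp i.2
            simp [glue, this] }
    rw [Fintype.sum_equiv E (fun z : Fin m → Fin 2 => ψ (glue A (fun i => x i) (fun i => z i)) *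
      (starRingEnd ℂ) (ψ (glue A (fun i => y i) (fun i => z i)))) (fun p => ψ (glue A (fun i => x i) p.2) *
      (starRingEnd ℂ) (ψ (glue A (fun i => y i) p.2))) (fun z => rfl)]
    rw [Fintype.sum_prod_type]
    simp
  constructor
  · intro h x y
    rw [key, h]
    simp only [Matrix.smul_apply, Matrix.one_apply, smul_eq_mul]
    rw [mul_inv_cancel_left₀ hpow]
    congr 1
    simp [funext_iff]
  · intro h
    unfold MaximallyMixed
    ext u v
    have := h (glue A u (fun _ => 0)) (glue A v (fun _ => 0))
    rw [key] at this
    have hu : ∀ u : {i // i ∈ A} → Fin 2,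
        (fun i : {i // i ∈ A} => glue A u (fun _ => 0) i) = u := by
      intro u; ext i; simp [glue, i.2]
    rw [hu, hu] at this
    simp only [Matrix.smul_apply, Matrix.one_apply, smul_eq_mul]
    rw [eq_inv_mul_iff_mul_eq₀ hpow, this]
    congr 1
    simp only [eq_iff_iff, funext_iff]
    constructor
    · intro hh i
      have := hh i i.2
      simpa [glue, i.2] using this
    · intro hh i hi
      simpa [glue, hi] using hh ⟨i, hi⟩

lemma mm_perm {m : ℕ} (ψ : (Fin m → Fin 2) → ℂ) (A : Finset (Fin m)) (e : Equiv.Perm (Fin m)) :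
    MaximallyMixed (fun x => ψ (x ∘ e.symm)) A ↔ MaximallyMixed ψ (A.image e) := by
  classical
  rw [mm_iff, mm_iff]
  have hp : ∀ x z : Fin m → Fin 2, (A.piecewise x z) ∘ e.symm =
      (A.image e).piecewise (x ∘ e.symm) (z ∘ e.symm) := by
    intro x z; ext i
    have : i ∈ A.image e ↔ e.symm i ∈ A := by
      constructor
      · intro h
        obtain ⟨j, hj, rfl⟩ := Finset.mem_image.mp h
        simpa using hj
      · intro h; exact Finset.mem_image.mpr ⟨_, h, by simp⟩
    by_cases h : e.symm i ∈ A <;> simp [Finset.piecewise, h, this]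
  let E : (Fin m → Fin 2) ≃ (Fin m → Fin 2) := Equiv.arrowCongr e (Equiv.refl _)
  have hE : ∀ x, E x = x ∘ e.symm := fun x => rfl
  have hs : ∀ x y : Fin m → Fin 2,
    ∑ z : Fin m → Fin 2, ψ ((A.piecewise x z) ∘ e.symm) *
        (starRingEnd ℂ) (ψ ((A.piecewise y z) ∘ e.symm)) =
    ∑ z : Fin m → Fin 2, ψ ((A.image e).piecewise (E x) z) *
        (starRingEnd ℂ) (ψ ((A.image e).piecewise (E y) z)) := by
    intro x y
    refine Fintype.sum_equiv E _ _ fun z => ?_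
    rw [hp, hp, hE, hE, hE]
  have hc : ∀ x y : Fin m → Fin 2, (∀ i ∈ A, x i = y i) ↔ ∀ i ∈ A.image e, E x i = E y i := by
    intro x y
    simp [hE]
  constructor
  · intro h x y
    have := h (E.symm x) (E.symm y)
    rw [hs] at this
    simp only [hc, Equiv.apply_symm_apply] at this
    exact this
  · intro h x y
    rw [hs, h]
    simp only [hc]

lemma sum_cons {n : ℕ} (f : (Fin (n+1) → Fin 2) → ℂ) :
    ∑ z, f z = ∑ a, ∑ z, f (Matrix.vecCons a z) := by
  rw [← Fintype.sum_prod_type']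
  exact (Fintype.sum_equiv (Fin.consEquiv (fun _ : Fin (n+1) => Fin 2)) _ _ (fun _ => rfl)).symm

lemma sum6 (f : (Fin 6 → Fin 2) → ℂ) :
    ∑ z, f z = ∑ a, ∑ b, ∑ c, ∑ d, ∑ e, ∑ g, f ![a, b, c, d, e, g] := by
  have h0 : ∀ g : (Fin 0 → Fin 2) → ℂ, ∑ z, g z = g ![] := fun g => by
    rw [Fintype.sum_unique]
    exact congrArg g (Subsingleton.elim _ _)
  simp only [sum_cons, h0]

lemma pw (A : Finset (Fin 6)) (a b c d e g a' b' c' d' e' g' : Fin 2) :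
    A.piecewise ![a, b, c, d, e, g] ![a', b', c', d', e', g'] =
    ![if 0 ∈ A then a else a', if 1 ∈ A then b else b', if 2 ∈ A then c else c',
      if 3 ∈ A then d else d', if 4 ∈ A then e else e', if 5 ∈ A then g else g'] := by
  ext i
  fin_cases i <;> simp [Finset.piecewise]

lemma concrete (ψ : (Fin 6 → Fin 2) → ℂ)
    (h45 : MaximallyMixed ψ {4, 5}) (h013 : MaximallyMixed ψ {0, 1, 3})
    (h023 : MaximallyMixed ψ {0, 2, 3}) (h123 : MaximallyMixed ψ {1, 2, 3}) :
    MaximallyMixed ψ {0, 1, 2} := by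
  classical
  rw [mm_iff] at *
  have hc := core (fun a b c d w => ψ ![a, b, c, d, w.1, w.2])
  simp only [Fintype.sum_prod_type] at hc
  have hc := hc ?_ ?_ ?_ ?_
  · intro x y
    obtain ⟨x0, x1, x2, x3, x4, x5, rfl⟩ : ∃ a b c d e f, x = ![a, b, c, d, e, f] :=
      ⟨x 0, x 1, x 2, x 3, x 4, x 5, by ext i; fin_cases i <;> rfl⟩
    obtain ⟨y0, y1, y2, y3, y4, y5, rfl⟩ : ∃ a b c d e f, y = ![a, b, c, d, e, f] :=
      ⟨y 0, y 1, y 2, y 3, y 4, y 5, by ext i; fin_cases i <;> rfl⟩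
    have := hc x0 x1 x2 y0 y1 y2
    simp only [sum6, pw]
    simp at this
    simp
    split_ifs at this ⊢ <;> linear_combination 8 * this
  · rintro ⟨w1, w2⟩ ⟨w1', w2'⟩
    have := h45 ![0, 0, 0, 0, w1, w2] ![0, 0, 0, 0, w1', w2']
    simp only [sum6, pw] at this
    simp at this
    simp
    split_ifs at this ⊢ <;> linear_combination (1/4) * this
  · intro a b d a' b' d'
    have := h013 ![a, b, 0, d, 0, 0] ![a', b', 0, d', 0, 0]
    simp only [sum6, pw] at this
    simp at this
    simp
    split_ifs at this ⊢ <;> linear_combination (1/8) * this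
  · intro a b d a' b' d'
    have := h023 ![a, 0, b, d, 0, 0] ![a', 0, b', d', 0, 0]
    simp only [sum6, pw] at this
    simp at this
    simp
    split_ifs at this ⊢ <;> linear_combination (1/8) * this
  · intro a b d a' b' d'
    have := h123 ![0, a, b, d, 0, 0] ![0, a', b', d', 0, 0]
    simp only [sum6, pw] at this
    simp at this
    simp
    split_ifs at this ⊢ <;> linear_combination (1/8) * this

lemma comb : ∀ A A' : Finset (Fin 6), A.card = 3 → A'.card = 3 → A ≠ A' →
    ∃ d, d ∉ A ∧ ¬ A' ⊆ insert d A := by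
  intro A A' hA hA' hne
  by_contra! hcon
  have hsub : A' ⊆ A := by
    intro i hi
    by_contra hiA
    have hcard : (Aᶜ).card = 3 := by rw [Finset.card_compl, hA]; rfl
    obtain ⟨d, hd, hdi⟩ := Finset.exists_mem_ne (by omega : 1 < (Aᶜ).card) i
    have := hcon d (Finset.mem_compl.mp hd) hi
    rcases Finset.mem_insert.mp this with h | h
    · exact hdi h.symm
    · exact hiA h
  exact hne (Finset.eq_of_subset_of_card_le hsub (by omega)).symm

lemma perm_exists (A : Finset (Fin 6)) (hA : A.card = 3) (d : Fin 6) (hd : d ∉ A) :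
    ∃ e : Equiv.Perm (Fin 6), ({0, 1, 2} : Finset (Fin 6)).image e = A ∧ e 3 = d := by
  obtain ⟨a, b, c, hab, hac, hbc, rfl⟩ := Finset.card_eq_three.mp hA
  simp only [Finset.mem_insert, Finset.mem_singleton, not_or] at hd
  let f : Fin 4 → Fin 6 := ![a, b, c, d]
  have hf : Function.Injective f := by
    intro i j
    fin_cases i <;> fin_cases j <;> simp [f, hab, hac, hbc, hd, hab.symm, hac.symm, hbc.symm,
      Ne.symm hd.1, Ne.symm hd.2.1, Ne.symm hd.2.2]
  let g : Fin 4 → Fin 6 := Fin.castLE (by norm_num)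
  have hg : Function.Injective g := Fin.castLE_injective _
  obtain ⟨e, he⟩ : ∃ e : Equiv.Perm (Fin 6), ∀ i, e (g i) = f i := by
    classical
    refine ⟨((Equiv.ofInjective g hg).symm.trans (Equiv.ofInjective f hf)).extendSubtype, ?_⟩
    intro i
    rw [Equiv.extendSubtype_apply_of_mem _ _ ⟨i, rfl⟩]
    simp [Equiv.ofInjective_symm_apply hg]
  refine ⟨e, ?_, he 3⟩
  have h0 : e 0 = a := he 0
  have h1 : e 1 = b := he 1
  have h2 : e 2 = c := he 2
  simp [Finset.image_insert, h0, h1, h2]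

end S6

theorem stmt6 :
    ¬ ∃ ψ : (Fin 6 → Fin 2) → ℂ,
      (∑ x : Fin 6 → Fin 2, ‖ψ x‖ ^ 2 = 1) ∧
      (∀ A : Finset (Fin 6), A.card = 2 → MaximallyMixed ψ A) ∧
      {A : Finset (Fin 6) | A.card = 3 ∧ MaximallyMixed ψ A}.ncard = 18 := by
  classical
  rintro ⟨ψ, -, h2, h18⟩
  let P := (Finset.univ : Finset (Fin 6)).powersetCard 3
  have hP : P.card = 20 := by simp only [P, Finset.card_powersetCard, Finset.card_univ]; rfl
  have hS : (P.filter (fun A => MaximallyMixed ψ A)).card = 18 := by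
    rw [← h18, ← Set.ncard_coe_finset]
    congr 1
    ext A
    simp [P, Finset.mem_powersetCard]
  have hN : (P.filter (fun A => ¬ MaximallyMixed ψ A)).card = 2 := by
    have := Finset.card_filter_add_card_filter_not (s := P) (fun A => MaximallyMixed ψ A)
    omega
  obtain ⟨A, A', hne, hAA⟩ := Finset.card_eq_two.mp hN
  have hmem : ∀ B, (B.card = 3 ∧ ¬ MaximallyMixed ψ B) ↔ (B = A ∨ B = A') := by
    intro B
    have : B ∈ P.filter (fun A => ¬ MaximallyMixed ψ A) ↔ B ∈ ({A, A'} : Finset _) := by rw [hAA]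
    simpa [P, Finset.mem_powersetCard] using this
  obtain ⟨hA, hAn⟩ := (hmem A).mpr (Or.inl rfl)
  obtain ⟨hA', -⟩ := (hmem A').mpr (Or.inr rfl)
  obtain ⟨d, hd, hsub⟩ := S6.comb A A' hA hA' hne
  obtain ⟨e, heA, hed⟩ := S6.perm_exists A hA d hd
  have aux : ∀ B : Finset (Fin 6), B.card = 3 → 3 ∈ B → B ⊆ {0, 1, 2, 3} →
      MaximallyMixed ψ (B.image e) := by
    intro B hB h3 hB4
    by_contra hcon
    have hc : (B.image e).card = 3 := by rw [Finset.card_image_of_injective _ e.injective, hB]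
    have hdB : d ∈ B.image e := Finset.mem_image.mpr ⟨3, h3, hed⟩
    rcases (hmem _).mp ⟨hc, hcon⟩ with h | h
    · exact hd (h ▸ hdB)
    · apply hsub
      rw [← h, ← heA, ← hed]
      refine (Finset.image_subset_image hB4).trans ?_
      intro i hi
      simp only [Finset.image_insert, Finset.image_singleton, Finset.mem_insert,
        Finset.mem_singleton] at hi ⊢
      tauto
  have := S6.concrete (fun x => ψ (x ∘ e.symm))
    ((S6.mm_perm _ _ _).mpr (h2 _ (by rw [Finset.card_image_of_injective _ e.injective]; rfl)))
    ((S6.mm_perm _ _ _).mpr (aux _ (by decide) (by decide) (by decide)))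
    ((S6.mm_perm _ _ _).mpr (aux _ (by decide) (by decide) (by decide)))
    ((S6.mm_perm _ _ _).mpr (aux _ (by decide) (by decide) (by decide)))
  rw [S6.mm_perm, heA] at this
  exact hAn this
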